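/- arXiv:2403.11633 — 9 statements merged into one kernel-verified Lean document; each statement's English description precedes it below -/
import Mathlib

section
/- Consider an individual exporter facing a minimum quantity commitment mq > 0, maximizing Π(q, m) over all pairs with 0 ≤ q ≤ Q, m ≥ 0, and additionally m ≥ mq whenever q > 0. Then: (A) if Q ≥ mq, the maximum value equals max(Δ, 0), attained at (q, m) = (Q, Q) when Δ ≥ 0 and at (0, 0) when Δ < 0; (B) if Q < mq, the maximum value equals max(δ − mq * ru, 0), attained at (q, m) = (Q, mq) when δ − mq * ru ≥ 0 and at (0, 0) when δ − mq * ru < 0. -/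
noncomputable section

/-- Individual profit `Π(q, m)` of an exporter with capacity `Q`, fixed export cost `c`,
unit price `p`, over-supply penalty `ro` and under-supply penalty `ru`. -/
def profit (Q c p ro ru : ℝ) (q m : ℝ) : ℝ :=
  (if 0 < q then Q * p - c else 0) - max (q - m) 0 * ro - max (m - q) 0 * ru

theorem profit_self {Q : ℝ} (hQ : 0 < Q) (c p ro ru : ℝ) :
    profit Q c p ro ru Q Q = Q * p - c := by
  simp [profit, hQ]

theorem profit_zero_zero (Q c p ro ru : ℝ) : profit Q c p ro ru 0 0 = 0 := by
  simp [profit]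

theorem profit_capacity_of_le {Q m : ℝ} (hQ : 0 < Q) (hm : Q ≤ m) (c p ro ru : ℝ) :
    profit Q c p ro ru Q m = Q * (p + ru) - c - m * ru := by
  rw [profit, if_pos hQ, max_eq_right (sub_nonpos.mpr hm), max_eq_left (sub_nonneg.mpr hm)]
  ring

theorem profit_le_of_pos {ro q : ℝ} (hro : 0 ≤ ro) (hq : 0 < q)
    (Q c p ru m : ℝ) : profit Q c p ro ru q m ≤ Q * p - c - max (m - q) 0 * ru := by
  have h : 0 ≤ max (q - m) 0 * ro := mul_nonneg (le_max_right _ _) hro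
  rw [profit, if_pos hq]
  linarith

theorem profit_nonpos_of_not_pos {ro ru q : ℝ} (hro : 0 ≤ ro) (hru : 0 ≤ ru) (hq : ¬ 0 < q)
    (Q c p m : ℝ) : profit Q c p ro ru q m ≤ 0 := by
  have h₁ : 0 ≤ max (q - m) 0 * ro := mul_nonneg (le_max_right _ _) hro
  have h₂ : 0 ≤ max (m - q) 0 * ru := mul_nonneg (le_max_right _ _) hru
  rw [profit, if_neg hq]
  linarith

/-- individual exporting under a positive minimum quantity commitment `mq`:
feasible pairs satisfy `0 ≤ q ≤ Q`, `m ≥ 0` and `m ≥ mq` whenever `q > 0`.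
(A) If `Q ≥ mq`, the maximum value equals `max (Δ, 0)`, attained at `(Q, Q)` when `Δ ≥ 0`
and at `(0, 0)` when `Δ < 0`.  (B) If `Q < mq`, the maximum value equals
`max (δ − mq * ru, 0)`, attained at `(Q, mq)` when `δ − mq * ru ≥ 0` and at `(0, 0)` when
`δ − mq * ru < 0`, where `Δ = Q * p − c` and `δ = Q * (p + ru) − c`. -/
theorem individual_export_with_mqc (Q c p ro ru mq : ℝ)
    (hQ : 0 < Q) (hc : 0 ≤ c) (hp : 0 ≤ p) (hro : 0 ≤ ro) (hru : 0 ≤ ru) (hmq : 0 < mq) :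
    (mq ≤ Q →
      IsGreatest {x : ℝ | ∃ q m : ℝ, 0 ≤ q ∧ q ≤ Q ∧ 0 ≤ m ∧ (0 < q → mq ≤ m) ∧
          x = profit Q c p ro ru q m}
        (max (Q * p - c) 0) ∧
      (0 ≤ Q * p - c → profit Q c p ro ru Q Q = max (Q * p - c) 0) ∧
      (Q * p - c < 0 → profit Q c p ro ru 0 0 = max (Q * p - c) 0)) ∧
    (Q < mq →
      IsGreatest {x : ℝ | ∃ q m : ℝ, 0 ≤ q ∧ q ≤ Q ∧ 0 ≤ m ∧ (0 < q → mq ≤ m) ∧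
          x = profit Q c p ro ru q m}
        (max (Q * (p + ru) - c - mq * ru) 0) ∧
      (0 ≤ Q * (p + ru) - c - mq * ru →
        profit Q c p ro ru Q mq = max (Q * (p + ru) - c - mq * ru) 0) ∧
      (Q * (p + ru) - c - mq * ru < 0 →
        profit Q c p ro ru 0 0 = max (Q * (p + ru) - c - mq * ru) 0)) := by
  have zero_attains : ∀ {a : ℝ}, a < 0 → profit Q c p ro ru 0 0 = max a 0 := fun ha => by
    rw [profit_zero_zero, max_eq_right ha.le]
  refine ⟨fun h => ?_, fun h => ?_⟩
  · have full_attains : 0 ≤ Q * p - c → profit Q c p ro ru Q Q = max (Q * p - c) 0 :=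
      fun hΔ => by rw [profit_self hQ, max_eq_left hΔ]
    refine ⟨⟨?_, ?_⟩, full_attains, zero_attains⟩
    · rcases le_or_gt 0 (Q * p - c) with hΔ | hΔ
      · exact ⟨Q, Q, hQ.le, le_rfl, hQ.le, fun _ => h, (full_attains hΔ).symm⟩
      · exact ⟨0, 0, le_rfl, hQ.le, le_rfl, fun h₀ => absurd h₀ (lt_irrefl 0),
          (zero_attains hΔ).symm⟩
    · rintro x ⟨q, m, -, -, -, -, rfl⟩
      by_cases hq : 0 < q
      · have h₁ := profit_le_of_pos hro hq Q c p ru m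
        have h₂ : 0 ≤ max (m - q) 0 * ru := mul_nonneg (le_max_right _ _) hru
        exact le_max_of_le_left (by linarith)
      · exact le_max_of_le_right (profit_nonpos_of_not_pos hro hru hq Q c p m)
  · have full_attains : 0 ≤ Q * (p + ru) - c - mq * ru →
        profit Q c p ro ru Q mq = max (Q * (p + ru) - c - mq * ru) 0 :=
      fun hδ => by rw [profit_capacity_of_le hQ h.le, max_eq_left hδ]
    refine ⟨⟨?_, ?_⟩, full_attains, zero_attains⟩
    · rcases le_or_gt 0 (Q * (p + ru) - c - mq * ru) with hδ | hδ
      · exact ⟨Q, mq, hQ.le, le_rfl, hmq.le, fun _ => le_rfl, (full_attains hδ).symm⟩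
      · exact ⟨0, 0, le_rfl, hQ.le, le_rfl, fun h₀ => absurd h₀ (lt_irrefl 0),
          (zero_attains hδ).symm⟩
    · rintro x ⟨q, m, -, hqQ, -, hm, rfl⟩
      by_cases hq : 0 < q
      · have h₁ := profit_le_of_pos hro hq Q c p ru m
        have h₂ : (mq - Q) * ru ≤ max (m - q) 0 * ru :=
          mul_le_mul_of_nonneg_right (le_max_of_le_left (by linarith [hm hq])) hru
        exact le_max_of_le_left (by linarith)
      · exact le_max_of_le_right (profit_nonpos_of_not_pos hro hru hq Q c p m)

end
end

section
/- Let S ⊆ N be a coalition with ∑_{i∈S^E} Q i ≥ mq. Then the maximum of Π^S over all feasible pairs (q, m) equals ∑_{i∈S^E} Δ i, and it is attained at the solution defined by q i = Q i for i ∈ S^E, q i = 0 for i ∈ S \ S^E, and m = ∑_{i∈S^E} Q i. -/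
open Finset

noncomputable section

variable {ι : Type*}

/-- Full capacity margin `Δ i`. -/
def Dm (Q c : ι → ℝ) (p : ℝ) (i : ι) : ℝ := Q i * p - c i

/-- Essential players of a coalition `S`. -/
def SE [DecidableEq ι] (Q c : ι → ℝ) (p : ℝ) (S : Finset ι) : Finset ι :=
  S.filter fun i => 0 ≤ Dm Q c p i

/-- Coalition profit `Π^S(q, m)`. -/
def coalProfit [DecidableEq ι] (Q c : ι → ℝ) (p ro ru : ℝ) (S : Finset ι)
    (q : ι → ℝ) (m : ℝ) : ℝ :=
  (∑ i ∈ S.filter fun i => 0 < q i, Dm Q c p i)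
    - max ((∑ i ∈ S, q i) - m) 0 * ro - max (m - ∑ i ∈ S, q i) 0 * ru

/-- Feasibility of a pair `(q, m)` for coalition `S` under the MQC `mq`. -/
def feas (Q : ι → ℝ) (mq : ℝ) (S : Finset ι) (q : ι → ℝ) (m : ℝ) : Prop :=
  (∀ i ∈ S, 0 ≤ q i ∧ q i ≤ Q i) ∧ 0 ≤ m ∧ ((0 < ∑ i ∈ S, q i) → mq ≤ m)

/-- No production plan earns more than the total margin of the essential players. -/
theorem coalProfit_le_sum_Dm_SE [DecidableEq ι] {Q c : ι → ℝ} {p ro ru : ℝ}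
    (hro : 0 ≤ ro) (hru : 0 ≤ ru) (S : Finset ι) (q : ι → ℝ) (m : ℝ) :
    coalProfit Q c p ro ru S q m ≤ ∑ i ∈ SE Q c p S, Dm Q c p i := by
  have hsum : ∑ i ∈ S with 0 < q i, Dm Q c p i ≤ ∑ i ∈ SE Q c p S, Dm Q c p i := by
    rw [SE, sum_filter, sum_filter]
    refine sum_le_sum fun i _ => ?_
    split_ifs <;> linarith
  have hover := mul_nonneg (le_max_right ((∑ i ∈ S, q i) - m) 0) hro
  have hunder := mul_nonneg (le_max_right (m - ∑ i ∈ S, q i) 0) hru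
  unfold coalProfit
  linarith

theorem sum_ite_mem_SE [DecidableEq ι] (Q c : ι → ℝ) (p : ℝ) (S : Finset ι) :
    ∑ i ∈ S, (if i ∈ SE Q c p S then Q i else 0) = ∑ i ∈ SE Q c p S, Q i := by
  rw [sum_ite_mem, SE, inter_eq_right.mpr (filter_subset _ _)]

/-- Full production by exactly the essential players, with a matching commitment, earns their
total margin. -/
theorem coalProfit_essential_eq [DecidableEq ι] {Q c : ι → ℝ} {p ro ru : ℝ} {S : Finset ι}
    (hQ : ∀ i ∈ S, 0 < Q i) :
    coalProfit Q c p ro ru S (fun i => if i ∈ SE Q c p S then Q i else 0)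
        (∑ i ∈ SE Q c p S, Q i)
      = ∑ i ∈ SE Q c p S, Dm Q c p i := by
  have hproducers :
      (S.filter fun i => 0 < if i ∈ SE Q c p S then Q i else 0) = SE Q c p S := by
    ext i
    by_cases hi : i ∈ SE Q c p S
    · have hiS : i ∈ S := (mem_filter.mp hi).1
      simp [hi, hiS, hQ i hiS]
    · simp [hi]
  simp only [coalProfit, sum_ite_mem_SE, hproducers]
  simp

/-- if the essential players of a coalition `S` have total capacity at least
the MQC, the maximum of `Π^S` over feasible pairs equals `∑_{i ∈ S^E} Δ i`, attained at
`q i = Q i` on `S^E`, `q i = 0` elsewhere, and `m = ∑_{i ∈ S^E} Q i`. -/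
theorem coalition_optimal_when_essentials_cover_mqc [DecidableEq ι]
    (N : Finset ι) (hN : N.Nonempty) (Q c : ι → ℝ) (p ro ru mq : ℝ)
    (hQ : ∀ i ∈ N, 0 < Q i) (hc : ∀ i ∈ N, 0 ≤ c i)
    (hp : 0 ≤ p) (hro : 0 ≤ ro) (hru : 0 ≤ ru) (hmq : 0 < mq)
    (hQmq : ∀ i ∈ N, Q i < mq)
    (S : Finset ι) (hS : S ⊆ N)
    (hcover : mq ≤ ∑ i ∈ SE Q c p S, Q i) :
    IsGreatest {x : ℝ | ∃ q m, feas Q mq S q m ∧ x = coalProfit Q c p ro ru S q m}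
      (∑ i ∈ SE Q c p S, Dm Q c p i) ∧
    coalProfit Q c p ro ru S (fun i => if i ∈ SE Q c p S then Q i else 0)
        (∑ i ∈ SE Q c p S, Q i)
      = ∑ i ∈ SE Q c p S, Dm Q c p i := by
  have hQS : ∀ i ∈ S, 0 < Q i := fun i hi => hQ i (hS hi)
  refine ⟨⟨⟨_, _, ⟨fun i hi => ?_, hmq.le.trans hcover, fun _ => hcover⟩,
    (coalProfit_essential_eq hQS).symm⟩, ?_⟩, coalProfit_essential_eq hQS⟩
  · have hi' := hQS i hi
    split_ifs
    · exact ⟨hi'.le, le_rfl⟩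
    · exact ⟨le_rfl, hi'.le⟩
  · rintro x ⟨q, m, -, rfl⟩
    exact coalProfit_le_sum_Dm_SE hro hru S q m

end
end

section
/- Let S ⊆ N be a coalition with ∑_{i∈S^E} Q i < mq. If the maximum of Π^S over all feasible pairs (q, m) is attained at some feasible pair with ∑_{i∈S} q i > 0, then there exists an exporter set R with S^E ⊆ R ⊆ S^P such that the solution defined by q i = Q i for i ∈ R, q i = 0 for i ∈ S \ R, and m = max(mq, ∑_{i∈R} Q i) also attains the maximum of Π^S. -/
open Finset

noncomputable section

variable {ι : Type*}

/-- Under-supply adjusted margin `δ i`. -/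
def dm (Q c : ι → ℝ) (p ru : ℝ) (i : ι) : ℝ := Q i * (p + ru) - c i

/-- Potential players of a coalition `S`. -/
def SP [DecidableEq ι] (Q c : ι → ℝ) (p ru : ℝ) (S : Finset ι) : Finset ι :=
  S.filter fun i => 0 ≤ dm Q c p ru i

/-- Profit of full-capacity export on `R ⊆ S` with commitment `max mq (∑ i ∈ R, Q i)`. -/
lemma coalProfit_fullCapacity [DecidableEq ι] (Q c : ι → ℝ) (p ro ru mq : ℝ)
    {R S : Finset ι} (hR : R ⊆ S) (hQ : ∀ i ∈ S, 0 < Q i) :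
    coalProfit Q c p ro ru S (fun i => if i ∈ R then Q i else 0) (max mq (∑ i ∈ R, Q i))
      = ∑ i ∈ R, Dm Q c p i - max (mq - ∑ i ∈ R, Q i) 0 * ru := by
  have hfilter : (S.filter fun i => 0 < if i ∈ R then Q i else 0) = R := by
    ext i
    by_cases hi : i ∈ R
    · simp [hi, hR hi, hQ i (hR hi)]
    · simp [hi]
  have hsum : ∑ i ∈ S, (if i ∈ R then Q i else 0) = ∑ i ∈ R, Q i := by
    rw [Finset.sum_ite_mem, Finset.inter_eq_right.mpr hR]
  have hover : max (∑ i ∈ R, Q i - max mq (∑ i ∈ R, Q i)) 0 = 0 :=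
    max_eq_right (sub_nonpos.mpr (le_max_right _ _))
  have hunder : max mq (∑ i ∈ R, Q i) - ∑ i ∈ R, Q i = max (mq - ∑ i ∈ R, Q i) 0 := by
    rw [max_sub_sub_right mq _ _ |>.symm, sub_self]
  simp only [coalProfit, hfilter, hsum, hover, hunder]
  rw [max_eq_left (le_max_right (mq - ∑ i ∈ R, Q i) 0)]
  ring

/-- Full-capacity export on `R ⊆ S` with commitment `max mq (∑ i ∈ R, Q i)` is feasible. -/
lemma feas_fullCapacity [DecidableEq ι] {Q : ι → ℝ} {mq : ℝ} (R : Finset ι) {S : Finset ι}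
    (hQ : ∀ i ∈ S, 0 < Q i) (hmq : 0 ≤ mq) :
    feas Q mq S (fun i => if i ∈ R then Q i else 0) (max mq (∑ i ∈ R, Q i)) := by
  refine ⟨fun i hi => ?_, hmq.trans (le_max_left _ _), fun _ => le_max_left _ _⟩
  have := hQ i hi
  dsimp only
  split_ifs
  · exact ⟨this.le, le_rfl⟩
  · exact ⟨le_rfl, this.le⟩

/-- Dropping the non-potential exporters of `q` and adding the essential players, all at full
capacity, does not decrease the profit. -/
lemma coalProfit_le_fullCapacity [DecidableEq ι] {Q c q : ι → ℝ} {p ro ru mq m : ℝ}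
    {S : Finset ι} (hQ : ∀ i ∈ S, 0 < Q i) (hro : 0 ≤ ro) (hru : 0 ≤ ru) (hm : mq ≤ m)
    (hq : ∀ i ∈ S, 0 ≤ q i ∧ q i ≤ Q i) :
    coalProfit Q c p ro ru S q m ≤
      ∑ i ∈ (SP Q c p ru S).filter (fun i => 0 ≤ Dm Q c p i ∨ 0 < q i), Dm Q c p i
        - max (mq - ∑ i ∈ (SP Q c p ru S).filter (fun i => 0 ≤ Dm Q c p i ∨ 0 < q i), Q i) 0
          * ru := by
  set R := (SP Q c p ru S).filter (fun i => 0 ≤ Dm Q c p i ∨ 0 < q i) with hRdef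
  set D := S.filter (fun i => 0 < q i ∧ dm Q c p ru i < 0) with hDdef
  have hR : R = S.filter fun i => 0 ≤ dm Q c p ru i ∧ (0 ≤ Dm Q c p i ∨ 0 < q i) := by
    rw [hRdef, SP, Finset.filter_filter]
  have hdm : ∀ i, dm Q c p ru i = Dm Q c p i + Q i * ru := fun i => by
    simp only [dm, Dm]; ring
  have hmargin : ∑ i ∈ S.filter (fun i => 0 < q i), Dm Q c p i
      ≤ ∑ i ∈ R, Dm Q c p i - (∑ i ∈ D, Q i) * ru := by
    rw [hR, hDdef, Finset.sum_mul]
    simp only [Finset.sum_filter]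
    rw [← Finset.sum_sub_distrib]
    refine Finset.sum_le_sum fun i hi => ?_
    have h1 := mul_nonneg (hQ i hi).le hru
    have h2 := hdm i
    split_ifs <;> grind
  have hexport : ∑ i ∈ S, q i ≤ ∑ i ∈ R, Q i + ∑ i ∈ D, Q i := by
    rw [hR, hDdef]
    simp only [Finset.sum_filter]
    rw [← Finset.sum_add_distrib]
    refine Finset.sum_le_sum fun i hi => ?_
    have h1 := hQ i hi
    have h2 := hq i hi
    split_ifs <;> grind
  have hD : 0 ≤ ∑ i ∈ D, Q i :=
    Finset.sum_nonneg fun i hi => (hQ i (Finset.mem_filter.mp hi).1).le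
  have hshort : max (mq - ∑ i ∈ R, Q i) 0
      ≤ max (m - ∑ i ∈ S, q i) 0 + ∑ i ∈ D, Q i := by
    refine max_le ?_ (add_nonneg (le_max_right _ _) hD)
    linarith [le_max_left (m - ∑ i ∈ S, q i) 0]
  have hpenalty := mul_le_mul_of_nonneg_right hshort hru
  have hover : 0 ≤ max (∑ i ∈ S, q i - m) 0 * ro := mul_nonneg (le_max_right _ _) hro
  unfold coalProfit
  linarith

/-- if the essential players of `S` have total capacity below the MQC and
the maximum of `Π^S` is attained at some feasible pair with positive total export, then
there is an exporter set `R` with `S^E ⊆ R ⊆ S^P` such that exporting full capacity on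
`R`, nothing elsewhere, with commitment `max (mq, ∑_{i ∈ R} Q i)`, also attains the
maximum. -/
theorem coalition_optimal_when_essentials_below_mqc [DecidableEq ι]
    (N : Finset ι) (hN : N.Nonempty) (Q c : ι → ℝ) (p ro ru mq : ℝ)
    (hQ : ∀ i ∈ N, 0 < Q i) (hc : ∀ i ∈ N, 0 ≤ c i)
    (hp : 0 ≤ p) (hro : 0 ≤ ro) (hru : 0 ≤ ru) (hmq : 0 < mq)
    (hQmq : ∀ i ∈ N, Q i < mq)
    (S : Finset ι) (hS : S ⊆ N)
    (hbelow : ∑ i ∈ SE Q c p S, Q i < mq)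
    (q₀ : ι → ℝ) (m₀ : ℝ) (hfeas₀ : feas Q mq S q₀ m₀)
    (hpos : 0 < ∑ i ∈ S, q₀ i)
    (hopt : ∀ q m, feas Q mq S q m →
      coalProfit Q c p ro ru S q m ≤ coalProfit Q c p ro ru S q₀ m₀) :
    ∃ R : Finset ι, SE Q c p S ⊆ R ∧ R ⊆ SP Q c p ru S ∧
      coalProfit Q c p ro ru S (fun i => if i ∈ R then Q i else 0)
          (max mq (∑ i ∈ R, Q i))
        = coalProfit Q c p ro ru S q₀ m₀ := by
  have hQS : ∀ i ∈ S, 0 < Q i := fun i hi => hQ i (hS hi)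
  set R := (SP Q c p ru S).filter (fun i => 0 ≤ Dm Q c p i ∨ 0 < q₀ i) with hR
  have hRSP : R ⊆ SP Q c p ru S := Finset.filter_subset _ _
  refine ⟨R, fun i hi => ?_, hRSP, le_antisymm (hopt _ _ (feas_fullCapacity R hQS hmq.le)) ?_⟩
  · obtain ⟨hiS, hiD⟩ := Finset.mem_filter.mp hi
    refine Finset.mem_filter.mpr ⟨Finset.mem_filter.mpr ⟨hiS, ?_⟩, Or.inl hiD⟩
    have := mul_nonneg (hQS i hiS).le hru
    simp only [dm, Dm] at hiD ⊢
    linarith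
  · rw [coalProfit_fullCapacity Q c p ro ru mq (hRSP.trans (Finset.filter_subset _ _)) hQS]
    exact coalProfit_le_fullCapacity hQS hro hru (hfeas₀.2.2 hpos) hfeas₀.1

end
end

section
/- For every coalition S ⊆ N of a CE-situation, the value of the CE-game satisfies v(S) ≤ ∑_{i∈S^E} Δ i. -/
open Finset

noncomputable section

variable {ι : Type*}

/-- Complementary players of a coalition `S`. -/
def SC [DecidableEq ι] (Q c : ι → ℝ) (p ru : ℝ) (S : Finset ι) : Finset ι :=
  SP Q c p ru S \ SE Q c p S

/-- Profit `π(R)` of an exporter set `R` (with `π(∅) = 0`). -/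
def piR [DecidableEq ι] (Q c : ι → ℝ) (p ru mq : ℝ) (R : Finset ι) : ℝ :=
  if R = ∅ then 0 else (∑ i ∈ R, Dm Q c p i) - max (mq - ∑ i ∈ R, Q i) 0 * ru

/-- The CE-game: `v(S)` is the maximum of `π` over all subsets of `S`. -/
def vG [DecidableEq ι] (Q c : ι → ℝ) (p ru mq : ℝ) (S : Finset ι) : ℝ :=
  S.powerset.sup' (Finset.powerset_nonempty S) (piR Q c p ru mq)

/-- `G^S(D)`: contribution of a set `D` of complementary players in coalition `S`. -/
def GS [DecidableEq ι] (Q c : ι → ℝ) (p ru mq : ℝ) (S D : Finset ι) : ℝ :=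
  (∑ i ∈ D, Dm Q c p i) + min (mq - ∑ i ∈ SE Q c p S, Q i) (∑ i ∈ D, Q i) * ru

/-- The NEA (Non-essential Exporter Altruistic) allocation. -/
def NEA [DecidableEq ι] (Q c : ι → ℝ) (p ru mq : ℝ) (N : Finset ι) (i : ι) : ℝ :=
  if i ∈ SE Q c p N then (Dm Q c p i / ∑ j ∈ SE Q c p N, Dm Q c p j) * vG Q c p ru mq N
  else 0

/-- Excess of a coalition `S` with respect to the NEA allocation of the game on `N`. -/
def exc [DecidableEq ι] (Q c : ι → ℝ) (p ru mq : ℝ) (N S : Finset ι) : ℝ :=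
  (∑ i ∈ S, NEA Q c p ru mq N i) - vG Q c p ru mq S

/-- The profit of a subset of `S` is at most the total margin of the essential players of `S`. -/
theorem piR_le_sum_essential_margins [DecidableEq ι] (Q c : ι → ℝ) (p ru mq : ℝ) (hru : 0 ≤ ru)
    {R S : Finset ι} (hRS : R ⊆ S) :
    piR Q c p ru mq R ≤ ∑ i ∈ SE Q c p S, Dm Q c p i := by
  have hsum : ∑ i ∈ R, Dm Q c p i ≤ ∑ i ∈ SE Q c p S, Dm Q c p i := by
    rw [SE, Finset.sum_filter]
    calc ∑ i ∈ R, Dm Q c p i ≤ ∑ i ∈ R, if 0 ≤ Dm Q c p i then Dm Q c p i else 0 :=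
          Finset.sum_le_sum fun i _ => by split_ifs <;> linarith
      _ ≤ ∑ i ∈ S, if 0 ≤ Dm Q c p i then Dm Q c p i else 0 :=
          Finset.sum_le_sum_of_subset_of_nonneg hRS fun i _ _ => by split_ifs <;> linarith
  unfold piR
  split_ifs with hR
  · exact Finset.sum_nonneg fun i hi => (Finset.mem_filter.mp hi).2
  · have := mul_nonneg (le_max_right (mq - ∑ i ∈ R, Q i) 0) hru
    linarith

/-- for every coalition `S ⊆ N` of a CE-situation,
`v(S) ≤ ∑_{i ∈ S^E} Δ i`. -/
theorem value_le_sum_essential_margins [DecidableEq ι]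
    (N : Finset ι) (hN : N.Nonempty) (Q c : ι → ℝ) (p ru mq : ℝ)
    (hQ : ∀ i ∈ N, 0 < Q i) (hc : ∀ i ∈ N, 0 ≤ c i)
    (hp : 0 ≤ p) (hru : 0 ≤ ru) (hmq : 0 < mq)
    (hQmq : ∀ i ∈ N, Q i < mq)
    (S : Finset ι) (hS : S ⊆ N) :
    vG Q c p ru mq S ≤ ∑ i ∈ SE Q c p S, Dm Q c p i := by
  exact Finset.sup'_le _ _ fun R hR =>
    piR_le_sum_essential_margins Q c p ru mq hru (Finset.mem_powerset.mp hR)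

end
end

section
/- Let S ⊆ N be a coalition with S^E ≠ ∅ and ∑_{i∈S^E} Q i < mq. Then: (a) for every D ⊆ S^C, π(S^E ∪ D) = π(S^E) + G^S(D); (b) consequently, max over all R with S^E ⊆ R ⊆ S^P of π(R) equals π(S^E) + max over all D ⊆ S^C of G^S(D), and a set R with S^E ⊆ R ⊆ S^P maximizes π over all such sets if and only if R = S^E ∪ D for some D ⊆ S^C maximizing G^S over subsets of S^C. -/
open Finset

noncomputable section

variable {ι : Type*}

theorem SE_subset_SP [DecidableEq ι] {Q c : ι → ℝ} {p ru : ℝ} {S : Finset ι}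
    (hQ : ∀ i ∈ S, 0 ≤ Q i) (hru : 0 ≤ ru) : SE Q c p S ⊆ SP Q c p ru S := by
  intro i hi
  obtain ⟨hiS, hΔ⟩ := mem_filter.1 hi
  refine mem_filter.2 ⟨hiS, ?_⟩
  have := mul_nonneg (hQ i hiS) hru
  unfold Dm at hΔ
  unfold dm
  linarith

theorem piR_SE_union [DecidableEq ι] {Q c : ι → ℝ} {p ru mq : ℝ} {S D : Finset ι}
    (hSE : (SE Q c p S).Nonempty) (hbelow : ∑ i ∈ SE Q c p S, Q i ≤ mq)
    (hD : Disjoint (SE Q c p S) D) :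
    piR Q c p ru mq (SE Q c p S ∪ D) = piR Q c p ru mq (SE Q c p S) + GS Q c p ru mq S D := by
  have hmax : max (mq - (∑ i ∈ SE Q c p S, Q i + ∑ i ∈ D, Q i)) 0 =
      (mq - ∑ i ∈ SE Q c p S, Q i) - min (mq - ∑ i ∈ SE Q c p S, Q i) (∑ i ∈ D, Q i) := by
    grind
  rw [piR, piR, GS, if_neg (hSE.mono subset_union_left).ne_empty, if_neg hSE.ne_empty,
    sum_union hD, sum_union hD, hmax, max_eq_left (sub_nonneg.2 hbelow)]
  ring

/-- let `S` be a coalition with `S^E ≠ ∅` and `∑_{i ∈ S^E} Q i < mq`. Then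
(a) for every `D ⊆ S^C`, `π(S^E ∪ D) = π(S^E) + G^S(D)`;
(b) the maximum of `π` over `{R : S^E ⊆ R ⊆ S^P}` equals `π(S^E)` plus the maximum of
`G^S` over subsets of `S^C`; and
(c) such an `R` maximizes `π` over all such sets iff `R = S^E ∪ D` for some `D ⊆ S^C`
maximizing `G^S` over subsets of `S^C`. -/
theorem optimal_exporters_via_complementary_contribution [DecidableEq ι]
    (N : Finset ι) (hN : N.Nonempty) (Q c : ι → ℝ) (p ru mq : ℝ)
    (hQ : ∀ i ∈ N, 0 < Q i) (hc : ∀ i ∈ N, 0 ≤ c i)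
    (hp : 0 ≤ p) (hru : 0 ≤ ru) (hmq : 0 < mq)
    (hQmq : ∀ i ∈ N, Q i < mq)
    (S : Finset ι) (hS : S ⊆ N)
    (hSE : (SE Q c p S).Nonempty)
    (hbelow : ∑ i ∈ SE Q c p S, Q i < mq) :
    (∀ D ⊆ SC Q c p ru S,
      piR Q c p ru mq (SE Q c p S ∪ D) = piR Q c p ru mq (SE Q c p S) + GS Q c p ru mq S D) ∧
    (∀ g : ℝ, IsGreatest {x : ℝ | ∃ D, D ⊆ SC Q c p ru S ∧ x = GS Q c p ru mq S D} g →
      IsGreatest {x : ℝ | ∃ R, SE Q c p S ⊆ R ∧ R ⊆ SP Q c p ru S ∧ x = piR Q c p ru mq R}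
        (piR Q c p ru mq (SE Q c p S) + g)) ∧
    (∀ R, SE Q c p S ⊆ R → R ⊆ SP Q c p ru S →
      ((∀ R', SE Q c p S ⊆ R' → R' ⊆ SP Q c p ru S →
          piR Q c p ru mq R' ≤ piR Q c p ru mq R) ↔
        ∃ D, D ⊆ SC Q c p ru S ∧ R = SE Q c p S ∪ D ∧
          ∀ D' ⊆ SC Q c p ru S, GS Q c p ru mq S D' ≤ GS Q c p ru mq S D)) := by
  have hEP : SE Q c p S ⊆ SP Q c p ru S := SE_subset_SP (fun i hi => (hQ i (hS hi)).le) hru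
  have hpi : ∀ D ⊆ SC Q c p ru S,
      piR Q c p ru mq (SE Q c p S ∪ D) =
        piR Q c p ru mq (SE Q c p S) + GS Q c p ru mq S D :=
    fun D hD => piR_SE_union hSE hbelow.le (disjoint_sdiff.mono_right hD)
  have hunion : ∀ D ⊆ SC Q c p ru S, SE Q c p S ∪ D ⊆ SP Q c p ru S :=
    fun D hD => union_subset hEP (hD.trans sdiff_subset)
  have hdecomp : ∀ R, SE Q c p S ⊆ R → R ⊆ SP Q c p ru S →
      ∃ D ⊆ SC Q c p ru S, R = SE Q c p S ∪ D :=
    fun R hER hRP => ⟨R \ SE Q c p S, sdiff_subset_sdiff hRP subset_rfl,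
      (union_sdiff_of_subset hER).symm⟩
  refine ⟨hpi, ?_, ?_⟩
  · rintro g ⟨⟨D, hD, rfl⟩, hmax⟩
    refine ⟨⟨SE Q c p S ∪ D, subset_union_left, hunion D hD, (hpi D hD).symm⟩, ?_⟩
    rintro _ ⟨R, hER, hRP, rfl⟩
    obtain ⟨D', hD', rfl⟩ := hdecomp R hER hRP
    rw [hpi D' hD']
    exact add_le_add_right (hmax ⟨D', hD', rfl⟩) _
  · intro R hER hRP
    constructor
    · intro hmax
      obtain ⟨D, hD, rfl⟩ := hdecomp R hER hRP
      refine ⟨D, hD, rfl, fun D' hD' => ?_⟩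
      have := hmax _ subset_union_left (hunion D' hD')
      rw [hpi D hD, hpi D' hD'] at this
      exact le_of_add_le_add_left this
    · rintro ⟨D, hD, rfl, hmax⟩ R' hER' hRP'
      obtain ⟨D', hD', rfl⟩ := hdecomp R' hER' hRP'
      rw [hpi D hD, hpi D' hD']
      exact add_le_add_right (hmax D' hD') _

end
end

section
/- Let S^0 ⊆ N^E be a set of essential players and S := S^0 ∪ N^C, so that S^E = S^0 and S^C = N^C. Assume ∑_{i∈N^E} Q i < mq, v(S) > 0 and v(N) > 0. Let D^S be any maximizer of G^S over subsets of N^C and D^N any maximizer of G^N over subsets of N^C, and set R^S := S^0 ∪ D^S and R^N := N^E ∪ D^N. Then ∑_{i∈D^S} Δ i − max(mq − ∑_{i∈R^S} Q i, 0) * ru ≤ ∑_{i∈D^N} Δ i − max(mq − ∑_{i∈R^N} Q i, 0) * ru. -/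
open Finset

noncomputable section

variable {ι : Type*}

/-- Shortage expressed through the fill-up term of `GS`, over disjoint exporter sets. -/
lemma max_sub_sum_union_eq [DecidableEq ι] {A D : Finset ι} (h : Disjoint A D)
    (Q : ι → ℝ) (mq : ℝ) :
    max (mq - ∑ i ∈ A ∪ D, Q i) 0 =
      (mq - ∑ i ∈ A, Q i) - min (mq - ∑ i ∈ A, Q i) (∑ i ∈ D, Q i) := by
  rw [Finset.sum_union h]
  grind

/-- for `S = S⁰ ∪ N^C` with `S⁰ ⊆ N^E` (so `S^E = S⁰`, `S^C = N^C`),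
if `∑_{i ∈ N^E} Q i < mq`, `v(S) > 0` and `v(N) > 0`, then for any maximizer `D^S` of
`G^S` and any maximizer `D^N` of `G^N` over subsets of `N^C`, setting
`R^S = S⁰ ∪ D^S` and `R^N = N^E ∪ D^N`,
`∑_{i ∈ D^S} Δ i − max(mq − ∑_{i ∈ R^S} Q i, 0) ru ≤
 ∑_{i ∈ D^N} Δ i − max(mq − ∑_{i ∈ R^N} Q i, 0) ru`. -/
theorem complementary_net_contribution_monotone [DecidableEq ι]
    (N : Finset ι) (hN : N.Nonempty) (Q c : ι → ℝ) (p ru mq : ℝ)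
    (hQ : ∀ i ∈ N, 0 < Q i) (hc : ∀ i ∈ N, 0 ≤ c i)
    (hp : 0 ≤ p) (hru : 0 ≤ ru) (hmq : 0 < mq)
    (hQmq : ∀ i ∈ N, Q i < mq)
    (S0 : Finset ι) (hS0 : S0 ⊆ SE Q c p N)
    (hsum : ∑ i ∈ SE Q c p N, Q i < mq)
    (hvS : 0 < vG Q c p ru mq (S0 ∪ SC Q c p ru N))
    (hvN : 0 < vG Q c p ru mq N)
    (DS DN : Finset ι)
    (hDS : DS ⊆ SC Q c p ru N)
    (hDSmax : ∀ D ⊆ SC Q c p ru N,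
      GS Q c p ru mq (S0 ∪ SC Q c p ru N) D ≤ GS Q c p ru mq (S0 ∪ SC Q c p ru N) DS)
    (hDN : DN ⊆ SC Q c p ru N)
    (hDNmax : ∀ D ⊆ SC Q c p ru N, GS Q c p ru mq N D ≤ GS Q c p ru mq N DN) :
    (∑ i ∈ DS, Dm Q c p i) - max (mq - ∑ i ∈ S0 ∪ DS, Q i) 0 * ru ≤
      (∑ i ∈ DN, Dm Q c p i) - max (mq - ∑ i ∈ SE Q c p N ∪ DN, Q i) 0 * ru := by
  have hdisj : ∀ D ⊆ SC Q c p ru N, Disjoint (SE Q c p N) D := fun D hD =>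
    Finset.disjoint_sdiff.mono_right hD
  have hmax := hDNmax DS hDS
  have hshort : max (mq - ∑ i ∈ SE Q c p N ∪ DS, Q i) 0 ≤ max (mq - ∑ i ∈ S0 ∪ DS, Q i) 0 := by
    refine max_le_max (sub_le_sub_left ?_ mq) le_rfl
    refine Finset.sum_le_sum_of_subset_of_nonneg (Finset.union_subset_union_left hS0) ?_
    intro i hi _
    refine (hQ i ?_).le
    rcases Finset.mem_union.mp hi with h | h
    · exact (Finset.mem_filter.mp h).1
    · exact (Finset.mem_filter.mp (Finset.mem_sdiff.mp (hDS h)).1).1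
  have hpen := mul_le_mul_of_nonneg_right hshort hru
  rw [max_sub_sum_union_eq (hdisj DS hDS)] at hpen
  rw [max_sub_sum_union_eq (hdisj DN hDN)]
  unfold GS at hmax
  linarith

end
end

section
/- In the CE-game (N, v), removing non-potential players does not change a coalition's value: for every S ⊆ N and every T ⊆ S \ S^P (i.e., every T consisting of players i ∈ S with δ i < 0), v(S \ T) = v(S). -/
open Finset

noncomputable section

variable {ι : Type*}

/-- Discarding exporters with negative under-supply adjusted margin does not lower the profit. -/
theorem piR_le_piR_sdiff [DecidableEq ι] (Q c : ι → ℝ) {p ru mq : ℝ} (hru : 0 ≤ ru)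
    {R T : Finset ι} (hQ : ∀ i ∈ R, 0 ≤ Q i)
    (hT : ∀ i ∈ T, dm Q c p ru i ≤ 0) :
    piR Q c p ru mq R ≤ piR Q c p ru mq (R \ T) := by
  have hD : ∑ i ∈ R ∩ T, Dm Q c p i ≤ -((∑ i ∈ R ∩ T, Q i) * ru) := by
    rw [Finset.sum_mul, ← Finset.sum_neg_distrib]
    refine Finset.sum_le_sum fun i hi => ?_
    have h := hT i (Finset.mem_inter.mp hi).2
    simp only [dm, Dm] at h ⊢
    linarith
  have hq : 0 ≤ ∑ i ∈ R ∩ T, Q i :=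
    Finset.sum_nonneg fun i hi => hQ i (Finset.mem_inter.mp hi).1
  have hsD := Finset.sum_inter_add_sum_sdiff R T (Dm Q c p)
  have hsQ := Finset.sum_inter_add_sum_sdiff R T Q
  have hmax : max (mq - ∑ i ∈ R \ T, Q i) 0 * ru ≤
      (max (mq - ∑ i ∈ R, Q i) 0 + ∑ i ∈ R ∩ T, Q i) * ru := by
    refine mul_le_mul_of_nonneg_right (max_le ?_ ?_) hru
    · linarith [le_max_left (mq - ∑ i ∈ R, Q i) 0]
    · exact add_nonneg (le_max_right _ _) hq
  by_cases hR : R = ∅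
  · simp [hR]
  by_cases hRT : R \ T = ∅
  · simp only [piR, hR, hRT, if_true, if_false, Finset.sum_empty, sub_zero] at hsD hmax ⊢
    have := mul_nonneg (le_max_right mq 0) hru
    linarith
  · simp only [piR, hR, hRT, if_false]
    linarith

/-- removing non-potential players (those with `δ i < 0`) from a coalition
does not change its value in the CE-game. -/
theorem value_unchanged_removing_nonpotential [DecidableEq ι]
    (N : Finset ι) (hN : N.Nonempty) (Q c : ι → ℝ) (p ru mq : ℝ)
    (hQ : ∀ i ∈ N, 0 < Q i) (hc : ∀ i ∈ N, 0 ≤ c i)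
    (hp : 0 ≤ p) (hru : 0 ≤ ru) (hmq : 0 < mq)
    (hQmq : ∀ i ∈ N, Q i < mq)
    (S : Finset ι) (hS : S ⊆ N)
    (T : Finset ι) (hT : T ⊆ S)
    (hTP : ∀ i ∈ T, dm Q c p ru i < 0) :
    vG Q c p ru mq (S \ T) = vG Q c p ru mq S := by
  apply le_antisymm
  · exact Finset.sup'_mono _ (Finset.powerset_mono.mpr Finset.sdiff_subset)
      (Finset.powerset_nonempty _)
  · refine Finset.sup'_le _ _ fun R hR => ?_
    rw [Finset.mem_powerset] at hR
    exact (piR_le_piR_sdiff Q c hru (fun i hi => (hQ i (hS (hR hi))).le)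
      fun i hi => (hTP i hi).le).trans
        (Finset.le_sup' (piR Q c p ru mq)
          (Finset.mem_powerset.mpr (Finset.sdiff_subset_sdiff hR le_rfl)))

end
end

section
/- Every CE-game (N, v) is superadditive: for all coalitions S, T ⊆ N with S ∩ T = ∅, v(S ∪ T) ≥ v(S) + v(T). -/
open Finset

noncomputable section

variable {ι : Type*}

theorem piR_empty [DecidableEq ι] (Q c : ι → ℝ) (p ru mq : ℝ) :
    piR Q c p ru mq ∅ = 0 :=
  if_pos rfl

theorem piR_of_nonempty [DecidableEq ι] (Q c : ι → ℝ) (p ru mq : ℝ) {R : Finset ι}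
    (hR : R.Nonempty) :
    piR Q c p ru mq R = (∑ i ∈ R, Dm Q c p i) - max (mq - ∑ i ∈ R, Q i) 0 * ru :=
  if_neg hR.ne_empty

/-- Merging two disjoint exporter sets does not decrease the total profit. -/
theorem piR_add_le_piR_union [DecidableEq ι] {Q : ι → ℝ} (c : ι → ℝ) (p : ℝ) {ru : ℝ} (mq : ℝ)
    (hru : 0 ≤ ru) {A B : Finset ι} (hB : ∀ i ∈ B, 0 ≤ Q i) (hAB : Disjoint A B) :
    piR Q c p ru mq A + piR Q c p ru mq B ≤ piR Q c p ru mq (A ∪ B) := by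
  rcases A.eq_empty_or_nonempty with rfl | hA
  · simp [piR_empty]
  rcases B.eq_empty_or_nonempty with rfl | hBne
  · simp [piR_empty]
  rw [piR_of_nonempty _ _ _ _ _ hA, piR_of_nonempty _ _ _ _ _ hBne,
    piR_of_nonempty _ _ _ _ _ (hA.mono subset_union_left), sum_union hAB, sum_union hAB]
  have hsum : 0 ≤ ∑ i ∈ B, Q i := sum_nonneg hB
  have hA_le : max (mq - (∑ i ∈ A, Q i + ∑ i ∈ B, Q i)) 0 * ru
      ≤ max (mq - ∑ i ∈ A, Q i) 0 * ru := by
    gcongr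
    linarith
  have hB_nonneg : 0 ≤ max (mq - ∑ i ∈ B, Q i) 0 * ru := mul_nonneg (le_max_right _ _) hru
  linarith

/-- every CE-game is superadditive: for disjoint coalitions `S, T ⊆ N`,
`v(S ∪ T) ≥ v(S) + v(T)`. -/
theorem ce_game_superadditive [DecidableEq ι]
    (N : Finset ι) (hN : N.Nonempty) (Q c : ι → ℝ) (p ru mq : ℝ)
    (hQ : ∀ i ∈ N, 0 < Q i) (hc : ∀ i ∈ N, 0 ≤ c i)
    (hp : 0 ≤ p) (hru : 0 ≤ ru) (hmq : 0 < mq)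
    (hQmq : ∀ i ∈ N, Q i < mq)
    (S T : Finset ι) (hS : S ⊆ N) (hT : T ⊆ N) (hST : Disjoint S T) :
    vG Q c p ru mq S + vG Q c p ru mq T ≤ vG Q c p ru mq (S ∪ T) := by
  obtain ⟨A, hA, hvA⟩ := exists_mem_eq_sup' (powerset_nonempty S) (piR Q c p ru mq)
  obtain ⟨B, hB, hvB⟩ := exists_mem_eq_sup' (powerset_nonempty T) (piR Q c p ru mq)
  rw [mem_powerset] at hA hB
  calc vG Q c p ru mq S + vG Q c p ru mq T
      = piR Q c p ru mq A + piR Q c p ru mq B := congrArg₂ (· + ·) hvA hvB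
    _ ≤ piR Q c p ru mq (A ∪ B) :=
        piR_add_le_piR_union c p mq hru (fun i hi => (hQ i (hT (hB hi))).le)
          (hST.mono hA hB)
    _ ≤ vG Q c p ru mq (S ∪ T) :=
        le_sup' (piR Q c p ru mq) (mem_powerset.mpr (union_subset_union hA hB))

end
end

section
/- Let (N, v) be a CE-game with N^E ≠ ∅ and ∑_{j∈N^E} Δ j > 0, and let φ be the NEA allocation. Then φ belongs to the core of (N, v): ∑_{i∈N} φ i = v(N), and ∑_{i∈S} φ i ≥ v(S) for every coalition S ⊆ N. -/
open Finset

noncomputable section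

variable {ι : Type*}

theorem piR_le_vG [DecidableEq ι] (Q c : ι → ℝ) (p ru mq : ℝ) {R S : Finset ι} (h : R ⊆ S) :
    piR Q c p ru mq R ≤ vG Q c p ru mq S :=
  Finset.le_sup' (piR Q c p ru mq) (Finset.mem_powerset.2 h)

theorem vG_nonneg [DecidableEq ι] (Q c : ι → ℝ) (p ru mq : ℝ) (S : Finset ι) :
    0 ≤ vG Q c p ru mq S := by
  simpa [piR] using piR_le_vG Q c p ru mq (Finset.empty_subset S)

theorem sum_Dm_SE_nonneg [DecidableEq ι] (Q c : ι → ℝ) (p : ℝ) (S : Finset ι) :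
    0 ≤ ∑ i ∈ SE Q c p S, Dm Q c p i :=
  Finset.sum_nonneg fun _ hi => (Finset.mem_filter.1 hi).2

theorem sum_Dm_le_sum_SE [DecidableEq ι] (Q c : ι → ℝ) (p : ℝ) {R S : Finset ι} (h : R ⊆ S) :
    ∑ i ∈ R, Dm Q c p i ≤ ∑ i ∈ SE Q c p S, Dm Q c p i := by
  have hR : ∑ i ∈ R, Dm Q c p i ≤ ∑ i ∈ SE Q c p R, Dm Q c p i := by
    rw [SE, Finset.sum_filter]
    refine Finset.sum_le_sum fun i _ => ?_
    split_ifs with hi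
    · exact le_rfl
    · exact (not_le.1 hi).le
  exact hR.trans (Finset.sum_le_sum_of_subset_of_nonneg (Finset.filter_subset_filter _ h)
    fun i hi _ => (Finset.mem_filter.1 hi).2)

theorem piR_le_sum_SE [DecidableEq ι] (Q c : ι → ℝ) (p mq : ℝ) {ru : ℝ} (hru : 0 ≤ ru)
    {R S : Finset ι} (h : R ⊆ S) :
    piR Q c p ru mq R ≤ ∑ i ∈ SE Q c p S, Dm Q c p i := by
  unfold piR
  split_ifs
  · exact sum_Dm_SE_nonneg Q c p S
  · have := mul_nonneg (le_max_right (mq - ∑ i ∈ R, Q i) 0) hru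
    linarith [sum_Dm_le_sum_SE Q c p h]

/-- Adding a disjoint set of exporters with positive capacities to a nonempty exporter set
raises the profit by at least their total full capacity margin. -/
theorem piR_add_sum_le_piR_union [DecidableEq ι] (Q c : ι → ℝ) (p mq : ℝ) {ru : ℝ} (hru : 0 ≤ ru)
    {R D : Finset ι} (hR : R.Nonempty) (hRD : Disjoint R D) (hD : ∀ i ∈ D, 0 ≤ Q i) :
    piR Q c p ru mq R + ∑ i ∈ D, Dm Q c p i ≤ piR Q c p ru mq (R ∪ D) := by
  rw [piR, piR, if_neg hR.ne_empty, if_neg (hR.mono Finset.subset_union_left).ne_empty,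
    Finset.sum_union hRD, Finset.sum_union hRD]
  have hQD := Finset.sum_nonneg hD
  have hmax : max (mq - (∑ i ∈ R, Q i + ∑ i ∈ D, Q i)) 0 ≤ max (mq - ∑ i ∈ R, Q i) 0 :=
    max_le_max_right 0 (by linarith)
  linarith [mul_le_mul_of_nonneg_right hmax hru]

theorem sum_NEA [DecidableEq ι] (Q c : ι → ℝ) (p ru mq : ℝ) {S N : Finset ι} (h : S ⊆ N) :
    ∑ i ∈ S, NEA Q c p ru mq N i =
      (∑ i ∈ SE Q c p S, Dm Q c p i) / (∑ j ∈ SE Q c p N, Dm Q c p j) * vG Q c p ru mq N := by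
  rw [Finset.sum_div, Finset.sum_mul, SE, Finset.sum_filter]
  refine Finset.sum_congr rfl fun i hi => ?_
  simp only [NEA, SE, Finset.mem_filter, h hi, true_and]

/-- if `N^E ≠ ∅` and `∑_{j ∈ N^E} Δ j > 0`, the NEA allocation `φ` belongs
to the core of the CE-game: `∑_{i ∈ N} φ i = v(N)` and `∑_{i ∈ S} φ i ≥ v(S)` for every
coalition `S ⊆ N`. -/
theorem nea_in_core [DecidableEq ι]
    (N : Finset ι) (hN : N.Nonempty) (Q c : ι → ℝ) (p ru mq : ℝ)
    (hQ : ∀ i ∈ N, 0 < Q i) (hc : ∀ i ∈ N, 0 ≤ c i)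
    (hp : 0 ≤ p) (hru : 0 ≤ ru) (hmq : 0 < mq)
    (hQmq : ∀ i ∈ N, Q i < mq)
    (hNE : (SE Q c p N).Nonempty)
    (hsum : 0 < ∑ j ∈ SE Q c p N, Dm Q c p j) :
    (∑ i ∈ N, NEA Q c p ru mq N i = vG Q c p ru mq N) ∧
    ∀ S ⊆ N, vG Q c p ru mq S ≤ ∑ i ∈ S, NEA Q c p ru mq N i := by
  refine ⟨by rw [sum_NEA Q c p ru mq Subset.rfl, div_self hsum.ne', one_mul], fun S hS => ?_⟩
  rw [sum_NEA Q c p ru mq hS, div_mul_eq_mul_div, le_div_iff₀ hsum]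
  obtain ⟨R, hRS, hR⟩ := Finset.exists_mem_eq_sup' (Finset.powerset_nonempty S) (piR Q c p ru mq)
  rw [Finset.mem_powerset] at hRS
  change vG Q c p ru mq S = _ at hR
  rw [hR]
  rcases R.eq_empty_or_nonempty with rfl | hRne
  · simpa [piR] using mul_nonneg (sum_Dm_SE_nonneg Q c p S) (vG_nonneg Q c p ru mq N)
  have hSE : SE Q c p S ⊆ SE Q c p N := Finset.filter_subset_filter _ hS
  have hDN : SE Q c p N \ SE Q c p S ⊆ N :=
    Finset.sdiff_subset.trans (Finset.filter_subset _ _)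
  have hdisj : Disjoint R (SE Q c p N \ SE Q c p S) := by
    rw [Finset.disjoint_left]
    intro i hi hiD
    rw [Finset.mem_sdiff] at hiD
    exact hiD.2 (Finset.mem_filter.2 ⟨hRS hi, (Finset.mem_filter.1 hiD.1).2⟩)
  have hadd := (piR_add_sum_le_piR_union Q c p mq hru hRne hdisj
    fun i hi => (hQ i (hDN hi)).le).trans
      (piR_le_vG Q c p ru mq (Finset.union_subset (hRS.trans hS) hDN))
  have hsdiff := Finset.sum_sdiff (f := Dm Q c p) hSE
  have hD : 0 ≤ ∑ i ∈ SE Q c p N \ SE Q c p S, Dm Q c p i :=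
    Finset.sum_nonneg fun i hi => (Finset.mem_filter.1 (Finset.mem_sdiff.1 hi).1).2
  rw [← hsdiff]
  nlinarith [mul_le_mul_of_nonneg_left hadd (sum_Dm_SE_nonneg Q c p S),
    mul_nonneg hD (sub_nonneg.2 (piR_le_sum_SE Q c p mq hru hRS))]

end
end
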